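/- Assume α > 2 − 2/k and let γ satisfy k(2−α)/2 < γ < 1. Define the deviation levels a_n = n^{γ − k(2−α)/2}. Then c_{a_n}(n) = Θ( n^{1 + (γ−1)/(2(α−1))} ) as n → ∞; in particular, the polynomial order of the required hub weight does not depend on the clique size k. -/

import Mathlib

open MeasureTheory Filter Set
noncomputable section

/-- `f_n(h_1,…,h_k) = ∏_{1≤i<j≤k} min(h_i h_j/(μ n), 1)`. -/
def fDef (μ : ℝ) (n k : ℕ) (x : Fin k → ℝ) : ℝ :=
  ∏ p ∈ Finset.univ.filter (fun p : Fin k × Fin k => p.1 < p.2),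
    min (x p.1 * x p.2 / (μ * n)) 1

/-- Expected `k`-clique count `m_n^{(k)}`. -/
def mExp (ν : Measure ℝ) (μ : ℝ) (k n : ℕ) : ℝ :=
  (n.choose k : ℝ) *
    ∫ x in Set.univ.pi (fun _ : Fin k => Set.Ici (1 : ℝ)),
      fDef μ n k x ∂(Measure.pi fun _ : Fin k => ν)

/-- The weight vector `(x, y, c, …, c)`. -/
def hubVec (k : ℕ) (x y c : ℝ) : Fin k → ℝ :=
  fun i => if i.val = 0 then x else if i.val = 1 then y else c

/-- `∫∫ f_n(x, y, c, …, c) dF(x) dF(y)`. -/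
def twoInt (ν : Measure ℝ) (μ : ℝ) (k n : ℕ) (c : ℝ) : ℝ :=
  ∫ x in Set.Ici (1 : ℝ), ∫ y in Set.Ici (1 : ℝ),
    fDef μ n k (hubVec k x y c) ∂ν ∂ν

/-- `c_a(n)`, the smallest hub size creating an expected excess of `a m_n^{(k)}` cliques. -/
def cA (ν : Measure ℝ) (μ : ℝ) (k : ℕ) (a : ℝ) (n : ℕ) : ℝ :=
  sInf {c : ℝ | 0 < c ∧ a * mExp ν μ k n < (n.choose 2 : ℝ) * twoInt ν μ k n c}


lemma tail_upper (α : ℝ) (hα : 0 < α) (ν : Measure ℝ) [IsProbabilityMeasure ν]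
    (htail : Tendsto (fun x : ℝ => x ^ α * (ν (Set.Ioi x)).toReal) atTop (nhds 1)) :
    ∃ K : ℝ, 0 < K ∧ ∀ x : ℝ, 0 < x → (ν (Set.Ioi x)).toReal ≤ K * x ^ (-α) := by
  have h := htail.eventually (gt_mem_nhds (show (1:ℝ) < 2 by norm_num))
  obtain ⟨x0, hx0⟩ := eventually_atTop.1 h
  refine ⟨max 2 (|x0| ^ α), by positivity, fun x hx => ?_⟩
  have hxa : 0 < x ^ α := Real.rpow_pos_of_pos hx _
  rw [Real.rpow_neg hx.le, ← div_eq_mul_inv, le_div_iff₀ hxa]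
  rcases le_or_gt x0 x with h1 | h1
  · have := hx0 x h1
    rw [mul_comm]
    exact this.le.trans (le_max_left _ _)
  · refine le_trans ?_ (le_max_right _ _)
    have hp : (ν (Set.Ioi x)).toReal ≤ 1 := by
      have := prob_le_one (μ := ν) (s := Ioi x)
      exact ENNReal.toReal_le_of_le_ofReal zero_le_one (by simpa using this)
    calc (ν (Set.Ioi x)).toReal * x ^ α ≤ 1 * x ^ α := by gcongr
      _ = x ^ α := one_mul _
      _ ≤ |x0| ^ α := Real.rpow_le_rpow hx.le (h1.le.trans (le_abs_self _)) hα.le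

lemma tail_lower (α : ℝ) (ν : Measure ℝ)
    (htail : Tendsto (fun x : ℝ => x ^ α * (ν (Set.Ioi x)).toReal) atTop (nhds 1)) :
    ∃ x0 : ℝ, 1 ≤ x0 ∧ ∀ x : ℝ, x0 ≤ x → 1 / 2 * x ^ (-α) ≤ (ν (Set.Ioi x)).toReal := by
  have h := htail.eventually (lt_mem_nhds (show (1/2:ℝ) < 1 by norm_num))
  obtain ⟨x0, hx0⟩ := eventually_atTop.1 h
  refine ⟨max 1 x0, le_max_left _ _, fun x hx => ?_⟩
  have hx1 : 0 < x := lt_of_lt_of_le one_pos ((le_max_left _ _).trans hx)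
  have hxa : 0 < x ^ α := Real.rpow_pos_of_pos hx1 _
  rw [Real.rpow_neg hx1.le, ← div_eq_mul_inv, div_le_iff₀ hxa, mul_comm _ (x ^ α)]
  exact (hx0 x ((le_max_right _ _).trans hx)).le

def gmin (s t u : ℝ) : ℝ := min (u ^ s) (u ^ t)

lemma gmin_nonneg {s t u : ℝ} (hu : 0 ≤ u) : 0 ≤ gmin s t u :=
  le_min (Real.rpow_nonneg hu _) (Real.rpow_nonneg hu _)

lemma gmin_measurable (s t : ℝ) : Measurable (gmin s t) := by
  unfold gmin
  exact (Measurable.pow_const measurable_id s).min (Measurable.pow_const measurable_id t)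

lemma hint_h (a b : ℝ) (ha : -1 < a) (hb : b < -1) :
    IntegrableOn (fun y : ℝ => min (y ^ a) (y ^ b)) (Ioi 0) := by
  have hm : Measurable (fun y : ℝ => min (y ^ a) (y ^ b)) :=
    (Measurable.pow_const measurable_id a).min (Measurable.pow_const measurable_id b)
  rw [← Ioc_union_Ioi_eq_Ioi (zero_le_one' ℝ)]
  refine IntegrableOn.union ?_ ?_
  · have h1 := intervalIntegral.intervalIntegrable_rpow' (a := 0) (b := 1) ha
    rw [intervalIntegrable_iff_integrableOn_Ioc_of_le zero_le_one] at h1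
    refine Integrable.mono' h1 hm.aestronglyMeasurable ?_
    refine (ae_restrict_mem measurableSet_Ioc).mono fun y hy => ?_
    rw [Real.norm_of_nonneg (le_min (Real.rpow_nonneg hy.1.le _) (Real.rpow_nonneg hy.1.le _))]
    exact min_le_left _ _
  · have h1 := integrableOn_Ioi_rpow_of_lt hb one_pos
    refine Integrable.mono' h1 hm.aestronglyMeasurable ?_
    refine (ae_restrict_mem measurableSet_Ioi).mono fun y hy => ?_
    have hy0 : (0:ℝ) ≤ y := zero_le_one.trans (le_of_lt hy)
    rw [Real.norm_of_nonneg (le_min (Real.rpow_nonneg hy0 _) (Real.rpow_nonneg hy0 _))]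
    exact min_le_right _ _

lemma ae_ge_one (ν : Measure ℝ) (hsupp : ν (Set.Iio 1) = 0) : ∀ᵐ x ∂ν, 1 ≤ x := by
  rw [ae_iff]; simpa [Iio, not_le] using hsupp

lemma g_bound (α s t : ℝ) (ht : 0 < t) (hta : t < α) (has : α < s) (ν : Measure ℝ)
    [IsProbabilityMeasure ν] (hsupp : ν (Set.Iio 1) = 0)
    (htail : Tendsto (fun x : ℝ => x ^ α * (ν (Set.Ioi x)).toReal) atTop (nhds 1)) :
    ∃ C : ℝ, 0 < C ∧ ∀ R : ℝ, 0 < R → Integrable (fun x => gmin s t (x / R)) ν ∧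
      ∫ x, gmin s t (x / R) ∂ν ≤ C * R ^ (-α) := by
  have hα : 0 < α := ht.trans hta
  have hs : 0 < s := hα.trans has
  obtain ⟨K, hK, hKt⟩ := tail_upper α hα ν htail
  have hI := hint_h (-(α / s)) (-(α / t)) (by rw [neg_lt_neg_iff, div_lt_one hs]; exact has)
    (by rw [neg_lt_neg_iff, one_lt_div ht]; exact hta)
  set J := ∫ y in Ioi (0:ℝ), min (y ^ (-(α / s))) (y ^ (-(α / t))) with hJ
  have hJ0 : 0 ≤ J := setIntegral_nonneg measurableSet_Ioi fun y hy =>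
    le_min (Real.rpow_nonneg (le_of_lt hy) _) (Real.rpow_nonneg (le_of_lt hy) _)
  refine ⟨K * (J + 1), by positivity, fun R hR => ?_⟩
  have hmeas : Measurable (fun x => gmin s t (x / R)) :=
    (gmin_measurable s t).comp (measurable_id.div_const R)
  have hnn : 0 ≤ᵐ[ν] (fun x => gmin s t (x / R)) := by
    filter_upwards [ae_ge_one ν hsupp] with x hx
    exact gmin_nonneg (by positivity)
  have hRa : 0 < R ^ (-α) := Real.rpow_pos_of_pos hR _
  have key : ∫⁻ x, ENNReal.ofReal (gmin s t (x / R)) ∂ν ≤ ENNReal.ofReal (K * R ^ (-α) * J) := by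
    rw [lintegral_eq_lintegral_meas_lt ν hnn hmeas.aemeasurable, hJ, ← integral_const_mul,
      ofReal_integral_eq_lintegral_ofReal (hI.const_mul _)]
    · refine setLIntegral_mono' measurableSet_Ioi fun y hy => ?_
      have hy0 : (0:ℝ) < y := hy
      have aux : ∀ r : ℝ, 0 < r → (∀ u : ℝ, gmin s t u ≤ u ^ r) →
          ν {x | y < gmin s t (x / R)} ≤ ENNReal.ofReal (K * R ^ (-α) * y ^ (-(α / r))) := by
        intro r hr hg
        have hsub : {x | y < gmin s t (x / R)} ≤ᵐ[ν] Ioi (R * y ^ (1 / r)) := by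
          filter_upwards [ae_ge_one ν hsupp] with x hx hxy
          have h1 : y < (x / R) ^ r := lt_of_lt_of_le hxy (hg _)
          have hxR : 0 ≤ x / R := by positivity
          have h2 : y ^ (1 / r) < x / R := by
            rw [one_div]
            exact (Real.rpow_inv_lt_iff_of_pos hy0.le hxR hr).2 h1
          show R * y ^ (1 / r) < x
          rw [lt_div_iff₀ hR] at h2
          linarith
        have hpos : 0 < y ^ (1 / r) := Real.rpow_pos_of_pos hy0 _
        refine (measure_mono_ae hsub).trans ?_
        rw [← ENNReal.ofReal_toReal (measure_ne_top ν (Ioi (R * y ^ (1 / r))))]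
        refine ENNReal.ofReal_le_ofReal ((hKt _ (by positivity)).trans_eq ?_)
        rw [Real.mul_rpow hR.le hpos.le, ← Real.rpow_mul hy0.le, mul_assoc]
        congr 3
        ring
      rcases min_cases (y ^ (-(α / s))) (y ^ (-(α / t))) with h | h
      · rw [h.1]; exact aux s hs fun u => min_le_left _ _
      · rw [h.1]; exact aux t ht fun u => min_le_right _ _
    · refine (ae_restrict_mem measurableSet_Ioi).mono fun y hy => ?_
      have hy0 : (0:ℝ) ≤ y := le_of_lt hy
      have := le_min (Real.rpow_nonneg hy0 (-(α / s))) (Real.rpow_nonneg hy0 (-(α / t)))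
      simp only [Pi.zero_apply]
      positivity
  have hint : Integrable (fun x => gmin s t (x / R)) ν := by
    refine ⟨hmeas.aestronglyMeasurable, ?_⟩
    rw [hasFiniteIntegral_iff_ofReal hnn]
    exact key.trans_lt ENNReal.ofReal_lt_top
  refine ⟨hint, ?_⟩
  rw [integral_eq_lintegral_of_nonneg_ae hnn hmeas.aestronglyMeasurable]
  refine (ENNReal.toReal_le_of_le_ofReal (by positivity) key).trans ?_
  nlinarith [mul_pos hK hRa]

/-- The three-variable inequality. -/
def Gl (s t v : ℝ) : ℝ := min (s * v) (t * v)

lemma Gl_of_nonneg {s t v : ℝ} (h : t ≤ s) (hv : 0 ≤ v) : Gl s t v = t * v :=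
  min_eq_right (by nlinarith)
lemma Gl_of_neg {s t v : ℝ} (h : t ≤ s) (hv : v ≤ 0) : Gl s t v = s * v :=
  min_eq_left (by nlinarith)

lemma min_le_lam (l x : ℝ) (h0 : 0 ≤ l) (h1 : l ≤ 1) : min x 0 ≤ l * x := by
  rcases le_total x 0 with h | h
  · rw [min_eq_left h]; nlinarith
  · rw [min_eq_right h]; positivity

lemma triple_sorted (t : ℝ) (ht1 : 1 < t) (ht2 : t < 2) (a b c : ℝ) (hab : a ≤ b) (hbc : b ≤ c) :
    min (a + b) 0 + min (b + c) 0 + min (a + c) 0 ≤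
      Gl (1 + t / 2) t a + Gl (1 + t / 2) t b + Gl (1 + t / 2) t c := by
  have hst : t ≤ 1 + t / 2 := by linarith
  rcases le_total c 0 with hc | hc
  · rw [Gl_of_neg hst hc, Gl_of_neg hst (hbc.trans hc), Gl_of_neg hst (hab.trans (hbc.trans hc)),
      min_eq_left (by linarith), min_eq_left (by linarith), min_eq_left (by linarith)]
    nlinarith
  rcases le_total b 0 with hb | hb
  · rw [Gl_of_nonneg hst hc, Gl_of_neg hst hb, Gl_of_neg hst (hab.trans hb),
      min_eq_left (a := a + b) (by linarith)]
    have h1 := min_le_lam (t / 2) (b + c) (by linarith) (by linarith)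
    have h2 := min_le_lam (t / 2) (a + c) (by linarith) (by linarith)
    nlinarith
  rcases le_total a 0 with ha | ha
  · rw [Gl_of_nonneg hst hc, Gl_of_nonneg hst hb, Gl_of_neg hst ha,
      min_eq_right (a := b + c) (by linarith)]
    have h1 := min_le_lam ((1 + t / 2) / 2) (a + b) (by linarith) (by linarith)
    have h2 := min_le_lam ((1 + t / 2) / 2) (a + c) (by linarith) (by linarith)
    nlinarith
  · rw [Gl_of_nonneg hst hc, Gl_of_nonneg hst hb, Gl_of_nonneg hst ha,
      min_eq_right (by linarith), min_eq_right (by linarith), min_eq_right (by linarith)]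
    nlinarith

lemma triple (t : ℝ) (ht1 : 1 < t) (ht2 : t < 2) (a b c : ℝ) :
    min (a + b) 0 + min (b + c) 0 + min (a + c) 0 ≤
      Gl (1 + t / 2) t a + Gl (1 + t / 2) t b + Gl (1 + t / 2) t c := by
  have H := triple_sorted t ht1 ht2
  rcases le_total a b with h1 | h1 <;> rcases le_total b c with h2 | h2 <;>
    rcases le_total a c with h3 | h3
  · exact H a b c h1 h2
  · exact H a b c h1 h2
  · have := H a c b h3 h2; rw [add_comm c b] at this; linarith
  · have := H c a b h3 h1; rw [add_comm c b, add_comm c a] at this; linarith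
  · have := H b a c h1 h3; rw [add_comm b a] at this; linarith
  · have := H b c a h2 h3; rw [add_comm b a, add_comm c a] at this; linarith
  · have := H c b a h2 h1; rw [add_comm c b, add_comm b a, add_comm c a] at this; linarith
  · have := H c b a h2 h1; rw [add_comm c b, add_comm b a, add_comm c a] at this; linarith

lemma offdiag_bound {ι : Type*} [DecidableEq ι] (t : ℝ) (ht1 : 1 < t) (ht2 : t < 2) (v : ι → ℝ)
    (m : ℕ) : ∀ A : Finset ι, A.card = m + 3 →
      ∑ p ∈ A.offDiag, min (v p.1 + v p.2) 0 ≤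
        ((m : ℝ) + 2) * ∑ i ∈ A, Gl (1 + t / 2) t (v i) := by
  induction m with
  | zero =>
    intro A hA
    obtain ⟨x, y, z, hxy, hxz, hyz, rfl⟩ := Finset.card_eq_three.1 hA
    have h := triple t ht1 ht2 (v x) (v y) (v z)
    have e : ({x, y, z} : Finset ι).offDiag = {(x,y),(x,z),(y,x),(y,z),(z,x),(z,y)} := by
      ext ⟨p, q⟩
      simp only [Finset.mem_offDiag, Finset.mem_insert, Finset.mem_singleton, Prod.mk.injEq]
      grind
    rw [e]
    repeat rw [Finset.sum_insert (by simp; grind)]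
    rw [Finset.sum_singleton]
    rw [Finset.sum_singleton]
    simp only [Nat.cast_zero]
    rw [add_comm (v y) (v x), add_comm (v z) (v x), add_comm (v z) (v y)]
    linarith
  | succ m ih =>
    intro A hA
    have e1 : ∑ l ∈ A, ∑ p ∈ (A.erase l).offDiag, min (v p.1 + v p.2) 0 =
        ((m : ℝ) + 2) * ∑ p ∈ A.offDiag, min (v p.1 + v p.2) 0 := by
      rw [Finset.sum_comm' (t' := A.offDiag) (s' := fun p => (A.erase p.1).erase p.2)]
      · rw [Finset.mul_sum]
        refine Finset.sum_congr rfl fun p hp => ?_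
        rw [Finset.mem_offDiag] at hp
        rw [Finset.sum_const, Finset.card_erase_of_mem, Finset.card_erase_of_mem hp.1, hA,
          nsmul_eq_mul]
        · congr 1
          rw [show m + 1 + 3 - 1 - 1 = m + 2 by omega]; push_cast; ring
        · exact Finset.mem_erase.2 ⟨Ne.symm hp.2.2, hp.2.1⟩
      · intro l p
        simp only [Finset.mem_offDiag, Finset.mem_erase]
        grind
    have e2 : ∑ l ∈ A, ∑ i ∈ A.erase l, Gl (1 + t / 2) t (v i) =
        ((m : ℝ) + 3) * ∑ i ∈ A, Gl (1 + t / 2) t (v i) := by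
      rw [Finset.sum_comm' (t' := A) (s' := fun i => A.erase i)]
      · rw [Finset.mul_sum]
        refine Finset.sum_congr rfl fun p hp => ?_
        rw [Finset.sum_const, Finset.card_erase_of_mem hp, hA, nsmul_eq_mul]
        congr 1
        rw [show m + 1 + 3 - 1 = m + 3 by omega]; push_cast; ring
      · intro l p
        simp only [Finset.mem_erase]
        grind
    have h3 : ∑ l ∈ A, ∑ p ∈ (A.erase l).offDiag, min (v p.1 + v p.2) 0 ≤
        ∑ l ∈ A, ((m : ℝ) + 2) * ∑ i ∈ A.erase l, Gl (1 + t / 2) t (v i) :=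
      Finset.sum_le_sum fun l hl => ih _ (by rw [Finset.card_erase_of_mem hl, hA]; omega)
    rw [← Finset.mul_sum, e1, e2] at h3
    have := le_of_mul_le_mul_left h3 (by positivity)
    push_cast
    linarith

lemma fDef_nonneg (μ : ℝ) (n k : ℕ) (x : Fin k → ℝ) (hD : 0 ≤ μ * n) (hx : ∀ i, 0 ≤ x i) :
    0 ≤ fDef μ n k x :=
  Finset.prod_nonneg fun p _ => le_min (div_nonneg (mul_nonneg (hx _) (hx _)) hD) zero_le_one

lemma fDef_le_one (μ : ℝ) (n k : ℕ) (x : Fin k → ℝ) (hD : 0 ≤ μ * n) (hx : ∀ i, 0 ≤ x i) :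
    fDef μ n k x ≤ 1 :=
  Finset.prod_le_one
    (fun p _ => le_min (div_nonneg (mul_nonneg (hx _) (hx _)) hD) zero_le_one)
    fun p _ => min_le_right _ _

lemma sum_lt_eq_half {k : ℕ} (f : Fin k → Fin k → ℝ) (hf : ∀ i j, f i j = f j i) :
    2 * ∑ p ∈ Finset.univ.filter (fun p : Fin k × Fin k => p.1 < p.2), f p.1 p.2 =
      ∑ p ∈ (Finset.univ : Finset (Fin k)).offDiag, f p.1 p.2 := by
  have e : (Finset.univ : Finset (Fin k)).offDiag =
      Finset.univ.filter (fun p : Fin k × Fin k => p.1 < p.2) ∪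
      Finset.univ.filter (fun p : Fin k × Fin k => p.2 < p.1) := by
    ext ⟨p, q⟩
    simp [lt_or_lt_iff_ne]
  have e2 : ∑ p ∈ Finset.univ.filter (fun p : Fin k × Fin k => p.2 < p.1), f p.1 p.2 =
      ∑ p ∈ Finset.univ.filter (fun p : Fin k × Fin k => p.1 < p.2), f p.1 p.2 := by
    refine Finset.sum_bij' (fun p _ => p.swap) (fun p _ => p.swap) ?_ ?_ ?_ ?_ ?_
    · intro p hp; simpa using hp
    · intro p hp; simpa using hp
    · intro p hp; simp
    · intro p hp; simp
    · intro p hp; simp only [Prod.fst_swap, Prod.snd_swap]; exact hf _ _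
  rw [e, Finset.sum_union, e2, two_mul]
  rw [Finset.disjoint_left]
  intro p hp hq
  simp only [Finset.mem_filter] at hp hq
  exact lt_asymm hp.2 hq.2

lemma gmin_eq_exp (s t u : ℝ) (hu : 0 < u) : gmin s t u = Real.exp (Gl s t (Real.log u)) := by
  unfold gmin Gl
  rw [Real.exp_monotone.map_min, Real.rpow_def_of_pos hu, Real.rpow_def_of_pos hu,
    mul_comm s, mul_comm t]

lemma fDef_le_prod (t : ℝ) (ht1 : 1 < t) (ht2 : t < 2) (μ : ℝ) (n k : ℕ) (hk : 3 ≤ k)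
    (hD : 0 < μ * n) (x : Fin k → ℝ) (hx : ∀ i, 0 < x i) :
    fDef μ n k x ≤ ∏ i, gmin (1 + t / 2) t (x i / Real.sqrt (μ * n)) := by
  set R := Real.sqrt (μ * n) with hR
  have hR0 : 0 < R := Real.sqrt_pos.2 hD
  have hRR : R * R = μ * n := Real.mul_self_sqrt hD.le
  set v : Fin k → ℝ := fun i => Real.log (x i / R) with hv
  have h1 : fDef μ n k x = Real.exp (∑ p ∈ Finset.univ.filter
      (fun p : Fin k × Fin k => p.1 < p.2), min (v p.1 + v p.2) 0) := by
    rw [Real.exp_sum]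
    refine Finset.prod_congr rfl fun p _ => ?_
    rw [Real.exp_monotone.map_min, Real.exp_zero, Real.exp_add, Real.exp_log (div_pos (hx _) hR0),
      Real.exp_log (div_pos (hx _) hR0), ← hRR]
    congr 1
    field_simp
  have h2 : ∏ i, gmin (1 + t / 2) t (x i / R) = Real.exp (∑ i, Gl (1 + t / 2) t (v i)) := by
    rw [Real.exp_sum]
    exact Finset.prod_congr rfl fun i _ => gmin_eq_exp _ _ _ (div_pos (hx _) hR0)
  rw [h1, h2, Real.exp_le_exp]
  obtain ⟨m, rfl⟩ : ∃ m, k = m + 3 := ⟨k - 3, by omega⟩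
  have h3 := offdiag_bound t ht1 ht2 v m Finset.univ (by simp)
  have h4 := sum_lt_eq_half (fun i j => min (v i + v j) 0) (fun i j => by rw [add_comm])
  rw [← h4] at h3
  have h5 : ∑ p ∈ Finset.univ.filter
      (fun p : Fin (m+3) × Fin (m+3) => p.1 < p.2), min (v p.1 + v p.2) 0 ≤ 0 :=
    Finset.sum_nonpos fun p _ => min_le_right _ _
  have hm : (0:ℝ) ≤ m := Nat.cast_nonneg m
  refine le_of_mul_le_mul_left (a := (m:ℝ) + 2) ?_ (by positivity)
  refine le_trans ?_ h3
  nlinarith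

lemma fDef_measurable (μ : ℝ) (n k : ℕ) : Measurable (fDef μ n k) := by
  unfold fDef
  refine Finset.measurable_prod _ fun p _ => ?_
  exact (((measurable_pi_apply p.1).mul (measurable_pi_apply p.2)).div_const _).min measurable_const

lemma restrict_Ici (ν : Measure ℝ) (hsupp : ν (Set.Iio 1) = 0) : ν.restrict (Ici 1) = ν :=
  Measure.restrict_eq_self_of_ae_mem (ae_ge_one ν hsupp)

lemma mInt_upper (α : ℝ) (hα : α ∈ Set.Ioo (1 : ℝ) 2)
    (ν : Measure ℝ) [IsProbabilityMeasure ν] (hsupp : ν (Set.Iio 1) = 0)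
    (htail : Tendsto (fun x : ℝ => x ^ α * (ν (Set.Ioi x)).toReal) atTop (nhds 1))
    (μ : ℝ) (hμ : 1 ≤ μ) (k : ℕ) (hk : 3 ≤ k) :
    ∃ M : ℝ, 0 < M ∧ ∀ n : ℕ, 0 < n →
      mExp ν μ k n ≤ M * (n : ℝ) ^ ((k : ℝ) * (2 - α) / 2) := by
  obtain ⟨t, ht, hta⟩ := exists_between (show max 1 (2 * α - 2) < α from
    max_lt hα.1 (by linarith [hα.2]))
  have ht1 : 1 < t := (le_max_left _ _).trans_lt ht
  have ht3 : 2 * α - 2 < t := (le_max_right _ _).trans_lt ht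
  have ht2 : t < 2 := hta.trans hα.2
  obtain ⟨C, hC, hCR⟩ := g_bound α (1 + t / 2) t (by linarith) hta (by linarith) ν hsupp htail
  refine ⟨C ^ k, by positivity, fun n hn => ?_⟩
  have hN : (0:ℝ) < n := Nat.cast_pos.2 hn
  have hD : 0 < μ * n := by positivity
  set R := Real.sqrt (μ * n) with hR
  have hR0 : 0 < R := Real.sqrt_pos.2 hD
  obtain ⟨hI, hb⟩ := hCR R hR0
  have e : (Measure.pi fun _ : Fin k => ν).restrict (Set.univ.pi (fun _ : Fin k => Set.Ici (1 : ℝ)))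
      = Measure.pi fun _ : Fin k => ν := by
    rw [Measure.restrict_pi_pi]
    simp_rw [restrict_Ici ν hsupp]
  have hae : ∀ᵐ x ∂(Measure.pi fun _ : Fin k => ν), ∀ i, 1 ≤ x i := by
    rw [← e]
    filter_upwards [ae_restrict_mem (MeasurableSet.univ_pi fun _ => measurableSet_Ici)] with x hx i
    exact hx i (mem_univ i)
  have h1 : ∫ x, fDef μ n k x ∂(Measure.pi fun _ : Fin k => ν) ≤
      ∫ x, ∏ i, gmin (1 + t / 2) t (x i / R) ∂(Measure.pi fun _ : Fin k => ν) := by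
    refine integral_mono_of_nonneg ?_ ?_ ?_
    · filter_upwards [hae] with x hx
      exact fDef_nonneg _ _ _ _ hD.le fun i => zero_le_one.trans (hx i)
    · exact Integrable.fintype_prod (f := fun _ : Fin k => fun x : ℝ => gmin (1 + t / 2) t (x / R))
        fun _ => hI
    · filter_upwards [hae] with x hx
      exact fDef_le_prod t ht1 ht2 μ n k hk hD x fun i => zero_lt_one.trans_le (hx i)
  have h2 : ∫ x, ∏ i, gmin (1 + t / 2) t (x i / R) ∂(Measure.pi fun _ : Fin k => ν) =
      (∫ x, gmin (1 + t / 2) t (x / R) ∂ν) ^ k := by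
    have := integral_fintype_prod_eq_pow (ι := Fin k) (μ := ν)
      (fun x : ℝ => gmin (1 + t / 2) t (x / R))
    simpa using this
  have h0 : 0 ≤ ∫ x, gmin (1 + t / 2) t (x / R) ∂ν := by
    refine integral_nonneg_of_ae ?_
    filter_upwards [ae_ge_one ν hsupp] with x hx
    exact gmin_nonneg (by positivity)
  unfold mExp
  rw [e]
  have hc : (n.choose k : ℝ) ≤ (n : ℝ) ^ k := by exact_mod_cast Nat.choose_le_pow n k
  have h3 : (C * R ^ (-α)) ^ k ≤ C ^ k * ((n:ℝ) ^ (-(α * k / 2))) := by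
    rw [mul_pow]
    gcongr
    rw [← Real.rpow_natCast, ← Real.rpow_mul hR0.le, hR, Real.sqrt_eq_rpow, ← Real.rpow_mul hD.le]
    have : (1 / 2 * (-α * (k:ℝ))) = -(α * k / 2) := by ring
    rw [this]
    refine Real.rpow_le_rpow_of_nonpos hN (by nlinarith) ?_
    have : 0 < α := by linarith [hα.1]
    have : 0 ≤ α * k / 2 := by positivity
    linarith
  calc (n.choose k : ℝ) * ∫ x, fDef μ n k x ∂(Measure.pi fun _ : Fin k => ν)
      ≤ (n:ℝ) ^ k * (C ^ k * ((n:ℝ) ^ (-(α * k / 2)))) := by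
        refine mul_le_mul hc ?_ ?_ (by positivity)
        · rw [h2] at h1
          exact h1.trans ((pow_le_pow_left₀ h0 hb k).trans h3)
        · refine integral_nonneg_of_ae ?_
          filter_upwards [hae] with x hx
          exact fDef_nonneg _ _ _ _ hD.le fun i => zero_le_one.trans (hx i)
    _ = C ^ k * (n : ℝ) ^ ((k : ℝ) * (2 - α) / 2) := by
        rw [← Real.rpow_natCast (n:ℝ) k, mul_left_comm, ← Real.rpow_add hN]
        congr 2
        ring

lemma mInt_lower (α : ℝ)
    (ν : Measure ℝ) [IsProbabilityMeasure ν]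
    (htail : Tendsto (fun x : ℝ => x ^ α * (ν (Set.Ioi x)).toReal) atTop (nhds 1))
    (μ : ℝ) (hμ : 1 ≤ μ) (k : ℕ) :
    ∃ M : ℝ, 0 < M ∧ ∃ n₀ : ℕ, ∀ n : ℕ, n₀ ≤ n →
      M * (n : ℝ) ^ ((k : ℝ) * (2 - α) / 2) ≤ mExp ν μ k n := by
  obtain ⟨x0, hx0, hlow⟩ := tail_lower α ν htail
  obtain ⟨n1, hn1⟩ := exists_nat_ge (x0 ^ 2)
  refine ⟨(1 / (2 ^ k * k.factorial)) * (1 / 2 * μ ^ (-(α / 2))) ^ k, by positivity,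
    max n1 (2 * k + 1), fun n hn => ?_⟩
  have hnn1 : n1 ≤ n := (le_max_left _ _).trans hn
  have hnk : 2 * k + 1 ≤ n := (le_max_right _ _).trans hn
  have hN : (0:ℝ) < n := Nat.cast_pos.2 (by omega)
  have hD : 0 < μ * n := by positivity
  set R := Real.sqrt (μ * n) with hR
  have hR0 : 0 < R := Real.sqrt_pos.2 hD
  have hRR : R * R = μ * n := Real.mul_self_sqrt hD.le
  have hRx : x0 ≤ R := by
    refine Real.le_sqrt_of_sq_le ?_
    have : (n1:ℝ) ≤ n := by exact_mod_cast hnn1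
    nlinarith
  have hp := hlow R hRx
  have hc : (1 / (2 ^ k * k.factorial)) * (n:ℝ) ^ k ≤ (n.choose k : ℝ) := by
    have h1 := Nat.pow_le_choose (α := ℝ) k n
    have h2 : (n:ℝ) / 2 ≤ ((n + 1 - k : ℕ) : ℝ) := by
      rw [Nat.cast_sub (by omega)]
      have : ((2 * k + 1 : ℕ) : ℝ) ≤ n := by exact_mod_cast hnk
      push_cast at this ⊢
      linarith
    have h3 : ((n:ℝ) / 2) ^ k ≤ ((n + 1 - k : ℕ) : ℝ) ^ k := pow_le_pow_left₀ (by positivity) h2 k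
    have hf : (0:ℝ) < k.factorial := by positivity
    have h4 : ((n:ℝ) / 2) ^ k ≤ k.factorial * (n.choose k : ℝ) := by
      refine h3.trans ?_
      have h1' := h1
      first
        | exact h1'
        | (rw [div_le_iff₀ hf] at h1'; linarith)
    rw [div_pow] at h4
    rw [div_mul_eq_mul_div, div_le_iff₀ (by positivity), one_mul]
    rw [div_le_iff₀ (by positivity)] at h4
    linarith
  have hint : (1 / 2 * R ^ (-α)) ^ k ≤
      ∫ x in Set.univ.pi (fun _ : Fin k => Set.Ici (1 : ℝ)),
      fDef μ n k x ∂(Measure.pi fun _ : Fin k => ν) := by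
    have hsub : Set.univ.pi (fun _ : Fin k => Set.Ioi R) ⊆
        Set.univ.pi (fun _ : Fin k => Set.Ici (1 : ℝ)) := by
      refine Set.pi_mono fun i _ x hx => ?_
      exact (hx0.trans hRx).trans (le_of_lt hx)
    have hmI : MeasurableSet (Set.univ.pi (fun _ : Fin k => Set.Ici (1 : ℝ))) :=
      MeasurableSet.univ_pi fun _ => measurableSet_Ici
    have hmO : MeasurableSet (Set.univ.pi (fun _ : Fin k => Set.Ioi R)) :=
      MeasurableSet.univ_pi fun _ => measurableSet_Ioi
    have hI : IntegrableOn (fDef μ n k) (Set.univ.pi (fun _ : Fin k => Set.Ici (1 : ℝ)))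
        (Measure.pi fun _ : Fin k => ν) := by
      refine Integrable.mono' (integrable_const (1:ℝ)) (fDef_measurable μ n k).aestronglyMeasurable ?_
      filter_upwards [ae_restrict_mem hmI] with x hx
      have hx' : ∀ i, 0 ≤ x i := fun i => zero_le_one.trans (hx i (mem_univ i))
      rw [Real.norm_of_nonneg (fDef_nonneg _ _ _ _ hD.le hx')]
      exact fDef_le_one _ _ _ _ hD.le hx'
    have h1 : ∫ x in Set.univ.pi (fun _ : Fin k => Set.Ioi R),
        fDef μ n k x ∂(Measure.pi fun _ : Fin k => ν) = ((ν (Ioi R)).toReal) ^ k := by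
      rw [setIntegral_congr_fun hmO (g := fun _ => (1:ℝ))]
      · simp [Measure.real, Measure.pi_pi, ENNReal.toReal_pow]
      · intro x hx
        refine Finset.prod_eq_one fun p _ => min_eq_right ?_
        rw [le_div_iff₀ hD, one_mul, ← hRR]
        exact mul_le_mul (le_of_lt (hx _ (mem_univ _))) (le_of_lt (hx _ (mem_univ _))) hR0.le
          (hR0.le.trans (le_of_lt (hx _ (mem_univ _))))
    calc (1 / 2 * R ^ (-α)) ^ k ≤ ((ν (Ioi R)).toReal) ^ k :=
          pow_le_pow_left₀ (by positivity) hp k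
      _ = _ := h1.symm
      _ ≤ _ := by
        refine setIntegral_mono_set hI ?_ hsub.eventuallyLE
        filter_upwards [ae_restrict_mem hmI] with x hx
        exact fDef_nonneg _ _ _ _ hD.le fun i => zero_le_one.trans (hx i (mem_univ i))
  unfold mExp
  refine le_trans (le_of_eq ?_) (mul_le_mul hc hint (by positivity) (by positivity))
  have e1 : R ^ (-α) = μ ^ (-(α / 2)) * (n:ℝ) ^ (-(α / 2)) := by
    rw [hR, Real.sqrt_eq_rpow, ← Real.rpow_mul hD.le, ← Real.mul_rpow (by positivity) hN.le]
    congr 1; ring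
  have e2 : (n : ℝ) ^ ((k : ℝ) * (2 - α) / 2) = (n:ℝ) ^ k * ((n:ℝ) ^ (-(α / 2))) ^ k := by
    rw [← Real.rpow_natCast (n:ℝ) k, ← Real.rpow_natCast _ k, ← Real.rpow_mul hN.le,
      ← Real.rpow_add hN]
    congr 1; ring
  rw [e1, e2]
  ring

lemma hubVec_nonneg {k : ℕ} {x y c : ℝ} (hx : 0 ≤ x) (hy : 0 ≤ y) (hc : 0 ≤ c) (i : Fin k) :
    0 ≤ hubVec k x y c i := by
  unfold hubVec; split_ifs <;> assumption

lemma hub_upper (μ : ℝ) (n k : ℕ) (hk : 3 ≤ k) (hD : 0 < μ * n) (x y c : ℝ)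
    (hx : 0 ≤ x) (hy : 0 ≤ y) (hc : 0 ≤ c) :
    fDef μ n k (hubVec k x y c) ≤
      (x * y / (μ * n)) * (min (x * c / (μ * n)) 1 * min (y * c / (μ * n)) 1) := by
  obtain ⟨m, rfl⟩ : ∃ m, k = m + 3 := ⟨k - 3, by omega⟩
  set i0 : Fin (m + 3) := ⟨0, by omega⟩ with hi0
  set i1 : Fin (m + 3) := ⟨1, by omega⟩ with hi1
  set i2 : Fin (m + 3) := ⟨2, by omega⟩ with hi2
  have h01 : i0 ≠ i1 := by simp [hi0, hi1]
  have h02 : i0 ≠ i2 := by simp [hi0, hi2]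
  have h12 : i1 ≠ i2 := by simp [hi1, hi2]
  have e0 : hubVec (m + 3) x y c i0 = x := by simp [hubVec, hi0]
  have e1 : hubVec (m + 3) x y c i1 = y := by simp [hubVec, hi1]
  have e2 : hubVec (m + 3) x y c i2 = c := by simp [hubVec, hi2]
  have hsub : ({(i0, i1), (i0, i2), (i1, i2)} : Finset (Fin (m+3) × Fin (m+3))) ⊆
      Finset.univ.filter (fun p : Fin (m+3) × Fin (m+3) => p.1 < p.2) := by
    intro p hp
    simp only [Finset.mem_insert, Finset.mem_singleton] at hp
    simp only [Finset.mem_filter, Finset.mem_univ, true_and]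
    rcases hp with rfl | rfl | rfl <;> simp [hi0, hi1, hi2, Fin.lt_def]
  have hfn : ∀ p : Fin (m+3) × Fin (m+3), 0 ≤ min (hubVec (m + 3) x y c p.1 *
      hubVec (m + 3) x y c p.2 / (μ * n)) 1 := fun p =>
    le_min (div_nonneg (mul_nonneg (hubVec_nonneg hx hy hc _) (hubVec_nonneg hx hy hc _)) hD.le)
      zero_le_one
  unfold fDef
  rw [← Finset.prod_sdiff hsub]
  refine (mul_le_of_le_one_left (Finset.prod_nonneg fun p _ => hfn p)
    (Finset.prod_le_one (fun p _ => hfn p) fun p _ => min_le_right _ _)).trans ?_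
  rw [Finset.prod_insert (by simp [h12, h01]), Finset.prod_insert (by simp [h01]),
    Finset.prod_singleton]
  simp only [e0, e1, e2]
  have a1 : 0 ≤ min (x * c / (μ * n)) 1 := le_min (by positivity) zero_le_one
  have a2 : 0 ≤ min (y * c / (μ * n)) 1 := le_min (by positivity) zero_le_one
  exact mul_le_mul_of_nonneg_right (min_le_left _ _) (mul_nonneg a1 a2)

lemma hub_lower (μ : ℝ) (n k : ℕ) (hk : 3 ≤ k) (hD : 0 < μ * n) (x y c b : ℝ)
    (hb : 0 < b) (hbc : b * c = μ * n) (hble : b ≤ c) (hx : b ≤ x) (hy : b ≤ y) :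
    b ^ 2 / (μ * n) ≤ fDef μ n k (hubVec k x y c) := by
  obtain ⟨m, rfl⟩ : ∃ m, k = m + 3 := ⟨k - 3, by omega⟩
  set i0 : Fin (m + 3) := ⟨0, by omega⟩ with hi0
  set i1 : Fin (m + 3) := ⟨1, by omega⟩ with hi1
  have e0 : hubVec (m + 3) x y c i0 = x := by simp [hubVec, hi0]
  have e1 : hubVec (m + 3) x y c i1 = y := by simp [hubVec, hi1]
  have hmem : (i0, i1) ∈ Finset.univ.filter (fun p : Fin (m+3) × Fin (m+3) => p.1 < p.2) := by
    rw [Finset.mem_filter]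
    exact ⟨Finset.mem_univ _, Fin.mk_lt_mk.2 (by norm_num)⟩
  have hge : ∀ i, b ≤ hubVec (m + 3) x y c i := by
    intro i; unfold hubVec; split_ifs <;> assumption
  unfold fDef
  rw [Finset.prod_eq_single_of_mem _ hmem]
  · simp only [e0, e1]
    refine le_min ?_ ?_
    · gcongr
      nlinarith
    · rw [div_le_one hD, ← hbc]; nlinarith
  · intro p hp hne
    refine min_eq_right ?_
    rw [Finset.mem_filter] at hp
    have hlt : p.1.val < p.2.val := hp.2
    have h2 : hubVec (m + 3) x y c p.2 = c := by
      have h0 : p.2.val ≠ 0 := by omega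
      have h1 : p.2.val ≠ 1 := by
        intro h
        apply hne
        refine Prod.ext (Fin.ext ?_) (Fin.ext ?_)
        · simp only [hi0]; omega
        · simp only [hi1]; omega
      simp [hubVec, h0, h1]
    rw [h2, le_div_iff₀ hD, one_mul, ← hbc]
    exact mul_le_mul_of_nonneg_right (hge _) (hb.le.trans hble)

lemma gmin_two_one (b x : ℝ) (hb : 0 < b) (hx : 0 ≤ x) :
    b * gmin 2 1 (x / b) = x * min (x / b) 1 := by
  unfold gmin
  have hu : 0 ≤ x / b := by positivity
  rw [Real.rpow_one, Real.rpow_two]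
  have : min ((x / b) ^ 2) (x / b) = (x / b) * min (x / b) 1 := by
    rw [mul_min_of_nonneg _ _ hu, mul_one, sq]
  rw [this, ← mul_assoc]
  congr 1
  field_simp

lemma two_upper (α : ℝ) (hα : α ∈ Set.Ioo (1 : ℝ) 2)
    (ν : Measure ℝ) [IsProbabilityMeasure ν] (hsupp : ν (Set.Iio 1) = 0)
    (htail : Tendsto (fun x : ℝ => x ^ α * (ν (Set.Ioi x)).toReal) atTop (nhds 1))
    (μ : ℝ) (hμ : 1 ≤ μ) (k : ℕ) (hk : 3 ≤ k) :
    ∃ M : ℝ, 0 < M ∧ ∀ n : ℕ, 0 < n → ∀ c : ℝ, 0 < c →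
      (n.choose 2 : ℝ) * twoInt ν μ k n c ≤ M * n * (n / c) ^ (2 - 2 * α) := by
  obtain ⟨C, hC, hCR⟩ := g_bound α 2 1 one_pos hα.1 hα.2 ν hsupp htail
  refine ⟨C ^ 2 * μ ^ (2 - 2 * α), by positivity, fun n hn c hc => ?_⟩
  have hN : (0:ℝ) < n := Nat.cast_pos.2 hn
  have hD : 0 < μ * n := by positivity
  set b := μ * n / c with hb
  have hb0 : 0 < b := by positivity
  obtain ⟨hI, hbd⟩ := hCR b hb0
  set h : ℝ → ℝ := fun x => b * gmin 2 1 (x / b) with hh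
  have hIh : Integrable h ν := hI.const_mul b
  have hhn : ∀ x, 0 ≤ x → 0 ≤ h x := fun x hx => mul_nonneg hb0.le (gmin_nonneg (by positivity))
  have hpt : ∀ x y, 0 ≤ x → 0 ≤ y →
      fDef μ n k (hubVec k x y c) ≤ h x / (μ * n) * h y := by
    intro x y hx hy
    refine (hub_upper μ n k hk hD x y c hx hy hc.le).trans_eq ?_
    simp only [hh]
    rw [gmin_two_one b x hb0 hx, gmin_two_one b y hb0 hy]
    have e : ∀ z : ℝ, z * c / (μ * n) = z / b := fun z => by rw [hb]; field_simp
    rw [e x, e y]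
    ring
  have hJ : ∫ x, h x ∂ν ≤ C * b ^ (1 - α) := by
    simp only [hh]
    rw [integral_const_mul]
    calc b * ∫ x, gmin 2 1 (x / b) ∂ν ≤ b * (C * b ^ (-α)) := by gcongr
      _ = C * b ^ (1 - α) := by rw [sub_eq_add_neg, Real.rpow_add hb0, Real.rpow_one]; ring
  have hJ0 : 0 ≤ ∫ x, h x ∂ν := by
    refine integral_nonneg_of_ae ?_
    filter_upwards [ae_ge_one ν hsupp] with x hx
    exact hhn x (by linarith)
  have hin : ∀ x, 0 ≤ x → 0 ≤ ∫ y, fDef μ n k (hubVec k x y c) ∂ν := by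
    intro x hx
    refine integral_nonneg_of_ae ?_
    filter_upwards [ae_ge_one ν hsupp] with y hy
    exact fDef_nonneg _ _ _ _ hD.le fun i => hubVec_nonneg hx (by linarith) hc.le i
  have h1 : twoInt ν μ k n c ≤ (∫ x, h x ∂ν) ^ 2 / (μ * n) := by
    unfold twoInt
    rw [restrict_Ici ν hsupp]
    calc _ ≤ ∫ x, h x / (μ * n) * ∫ y, h y ∂ν ∂ν := by
          refine integral_mono_of_nonneg ?_ ((hIh.div_const _).mul_const _) ?_
          · filter_upwards [ae_ge_one ν hsupp] with x hx
            exact hin x (by linarith)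
          · filter_upwards [ae_ge_one ν hsupp] with x hx
            have hx0 : 0 ≤ x := by linarith
            rw [← integral_const_mul]
            refine integral_mono_of_nonneg ?_ (hIh.const_mul _) ?_
            · filter_upwards [ae_ge_one ν hsupp] with y hy
              exact fDef_nonneg _ _ _ _ hD.le fun i => hubVec_nonneg hx0 (by linarith) hc.le i
            · filter_upwards [ae_ge_one ν hsupp] with y hy
              exact hpt x y hx0 (by linarith)
      _ = _ := by
          rw [integral_mul_const, integral_div]; ring
  have h2 : 0 ≤ twoInt ν μ k n c := by
    unfold twoInt
    rw [restrict_Ici ν hsupp]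
    refine integral_nonneg_of_ae ?_
    filter_upwards [ae_ge_one ν hsupp] with x hx
    exact hin x (by linarith)
  have hch : (n.choose 2 : ℝ) ≤ (n : ℝ) ^ 2 := by exact_mod_cast Nat.choose_le_pow n 2
  calc (n.choose 2 : ℝ) * twoInt ν μ k n c
      ≤ (n:ℝ) ^ 2 * ((C * b ^ (1 - α)) ^ 2 / (μ * n)) := by
        refine mul_le_mul hch (h1.trans ?_) h2 (by positivity)
        gcongr
    _ = C ^ 2 * (1 / μ) * n * (b ^ (1 - α)) ^ 2 := by field_simp
    _ = C ^ 2 * (1 / μ) * n * (μ ^ (2 - 2 * α) * (n / c) ^ (2 - 2 * α)) := by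
        congr 1
        rw [← Real.rpow_natCast, ← Real.rpow_mul hb0.le, ← Real.mul_rpow (by positivity) (by positivity),
          hb, mul_div_assoc]
        congr 1; push_cast; ring
    _ ≤ C ^ 2 * 1 * n * (μ ^ (2 - 2 * α) * (n / c) ^ (2 - 2 * α)) := by
        have : 1 / μ ≤ 1 := by rw [div_le_one (by linarith)]; exact hμ
        gcongr
    _ = _ := by ring

lemma hub_measurable (μ : ℝ) (n k : ℕ) (c : ℝ) :
    Measurable (fun p : ℝ × ℝ => fDef μ n k (hubVec k p.1 p.2 c)) := by
  refine (fDef_measurable μ n k).comp (measurable_pi_iff.2 fun i => ?_)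
  unfold hubVec
  split_ifs
  · exact measurable_fst
  · exact measurable_snd
  · exact measurable_const

lemma two_lower (α : ℝ)
    (ν : Measure ℝ) [IsProbabilityMeasure ν] (hsupp : ν (Set.Iio 1) = 0)
    (htail : Tendsto (fun x : ℝ => x ^ α * (ν (Set.Ioi x)).toReal) atTop (nhds 1))
    (μ : ℝ) (hμ : 1 ≤ μ) (k : ℕ) (hk : 3 ≤ k) :
    ∃ x0 : ℝ, 1 ≤ x0 ∧ ∀ n : ℕ, 2 ≤ n → ∀ c : ℝ, x0 ≤ μ * n / c → μ * n ≤ c ^ 2 → 0 < c →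
      1 / (16 * μ) * n * (μ * n / c) ^ (2 - 2 * α) ≤ (n.choose 2 : ℝ) * twoInt ν μ k n c := by
  obtain ⟨x0, hx0, hlow⟩ := tail_lower α ν htail
  refine ⟨x0, hx0, fun n hn c hbx hcc hc => ?_⟩
  have hN : (0:ℝ) < n := Nat.cast_pos.2 (by omega)
  have hD : 0 < μ * n := by positivity
  set b := μ * n / c with hb
  have hb0 : 0 < b := by positivity
  have hbc : b * c = μ * n := by rw [hb]; field_simp
  have hble : b ≤ c := by rw [hb, div_le_iff₀ hc]; nlinarith
  have hp := hlow b hbx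
  set q := (ν (Ioi b)).toReal with hq
  have hq0 : 0 ≤ q := ENNReal.toReal_nonneg
  have hae := ae_ge_one ν hsupp
  have hmeas := hub_measurable μ n k c
  have hfn : ∀ x y, 1 ≤ x → 1 ≤ y → 0 ≤ fDef μ n k (hubVec k x y c) := fun x y hx hy =>
    fDef_nonneg _ _ _ _ hD.le fun i => hubVec_nonneg (by linarith) (by linarith) hc.le i
  have hf1 : ∀ x y, 1 ≤ x → 1 ≤ y → fDef μ n k (hubVec k x y c) ≤ 1 := fun x y hx hy =>
    fDef_le_one _ _ _ _ hD.le fun i => hubVec_nonneg (by linarith) (by linarith) hc.le i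
  have hIy : ∀ x, 1 ≤ x → Integrable (fun y => fDef μ n k (hubVec k x y c)) ν := by
    intro x hx
    refine Integrable.mono' (integrable_const (1:ℝ))
      (hmeas.comp measurable_prodMk_left).aestronglyMeasurable ?_
    filter_upwards [hae] with y hy
    rw [Real.norm_of_nonneg (hfn x y hx hy)]
    exact hf1 x y hx hy
  have hg0 : ∀ x, 1 ≤ x → 0 ≤ ∫ y, fDef μ n k (hubVec k x y c) ∂ν := fun x hx =>
    integral_nonneg_of_ae (by filter_upwards [hae] with y hy using hfn x y hx hy)
  have hg1 : ∀ x, 1 ≤ x → ∫ y, fDef μ n k (hubVec k x y c) ∂ν ≤ 1 := by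
    intro x hx
    refine (integral_mono_ae (hIy x hx) (integrable_const (1:ℝ)) ?_).trans_eq (by simp)
    filter_upwards [hae] with y hy using hf1 x y hx hy
  have hIx : Integrable (fun x => ∫ y, fDef μ n k (hubVec k x y c) ∂ν) ν := by
    refine Integrable.mono' (integrable_const (1:ℝ))
      (hmeas.stronglyMeasurable.integral_prod_right').aestronglyMeasurable ?_
    filter_upwards [hae] with x hx
    rw [Real.norm_of_nonneg (hg0 x hx)]
    exact hg1 x hx
  have hb1 : 1 ≤ b := hx0.trans hbx
  have hinner : ∀ x, b < x → b ^ 2 / (μ * n) * q ≤ ∫ y, fDef μ n k (hubVec k x y c) ∂ν := by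
    intro x hx
    have hx1 : 1 ≤ x := hb1.trans hx.le
    calc b ^ 2 / (μ * n) * q = ∫ y in Ioi b, b ^ 2 / (μ * n) ∂ν := by
          simp [Measure.real, hq, mul_comm]
      _ ≤ ∫ y in Ioi b, fDef μ n k (hubVec k x y c) ∂ν := by
          refine setIntegral_mono_on (integrable_const _) (hIy x hx1).integrableOn
            measurableSet_Ioi fun y hy => ?_
          exact hub_lower μ n k hk hD x y c b hb0 hbc hble hx.le (le_of_lt hy)
      _ ≤ _ := by
          refine setIntegral_le_integral (hIy x hx1) ?_
          filter_upwards [hae] with y hy using hfn x y hx1 hy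
  have h1 : b ^ 2 / (μ * n) * q * q ≤ twoInt ν μ k n c := by
    unfold twoInt
    rw [restrict_Ici ν hsupp]
    calc b ^ 2 / (μ * n) * q * q = ∫ x in Ioi b, b ^ 2 / (μ * n) * q ∂ν := by
          simp only [integral_const, smul_eq_mul, measureReal_restrict_apply_univ]
          rw [mul_comm]; rfl
      _ ≤ ∫ x in Ioi b, ∫ y, fDef μ n k (hubVec k x y c) ∂ν ∂ν :=
          setIntegral_mono_on (integrable_const _) hIx.integrableOn
            measurableSet_Ioi fun x hx => hinner x hx
      _ ≤ _ := by
          refine setIntegral_le_integral hIx ?_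
          filter_upwards [hae] with x hx using hg0 x hx
  have hch : (n:ℝ) ^ 2 / 4 ≤ (n.choose 2 : ℝ) := by
    rw [Nat.cast_choose_two]
    have : (2:ℝ) ≤ n := by exact_mod_cast hn
    nlinarith
  calc 1 / (16 * μ) * n * b ^ (2 - 2 * α)
      = (n:ℝ) ^ 2 / 4 * (b ^ 2 / (μ * n) * (1 / 2 * b ^ (-α)) * (1 / 2 * b ^ (-α))) := by
        have e : b ^ (2 - 2 * α) = b ^ 2 * b ^ (-α) * b ^ (-α) := by
          rw [← Real.rpow_natCast b 2, ← Real.rpow_add hb0, ← Real.rpow_add hb0]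
          congr 1; push_cast; ring
        rw [e]
        field_simp
        norm_num
    _ ≤ (n:ℝ) ^ 2 / 4 * (b ^ 2 / (μ * n) * q * q) := by gcongr
    _ ≤ _ := mul_le_mul hch h1 (by positivity) (by positivity)

/-- for `α > 2 - 2/k` and `k(2-α)/2 < γ < 1`, with `a_n = n^{γ - k(2-α)/2}`,
`c_{a_n}(n) = Θ(n^{1 + (γ-1)/(2(α-1))})`. -/
theorem stmt16
    (α : ℝ) (hα : α ∈ Set.Ioo (1 : ℝ) 2)
    (ν : Measure ℝ) [IsProbabilityMeasure ν]
    (hsupp : ν (Set.Iio 1) = 0)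
    (htail : Tendsto (fun x : ℝ => x ^ α * (ν (Set.Ioi x)).toReal) atTop (nhds 1))
    (hint : Integrable (fun x : ℝ => x) ν)
    (μ : ℝ) (hμ : μ = ∫ x, x ∂ν)
    (k : ℕ) (hk : 3 ≤ k)
    (hα2 : 2 - 2 / (k : ℝ) < α)
    (γ : ℝ) (hγ1 : (k : ℝ) * (2 - α) / 2 < γ) (hγ2 : γ < 1) :
    ∃ c C : ℝ, ∃ n₀ : ℕ, 0 < c ∧ c ≤ C ∧ ∀ n, n₀ ≤ n →
      c * (n : ℝ) ^ (1 + (γ - 1) / (2 * (α - 1))) ≤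
          cA ν μ k ((n : ℝ) ^ (γ - (k : ℝ) * (2 - α) / 2)) n ∧
      cA ν μ k ((n : ℝ) ^ (γ - (k : ℝ) * (2 - α) / 2)) n ≤
          C * (n : ℝ) ^ (1 + (γ - 1) / (2 * (α - 1))) := by
  have hα1 := hα.1
  have hα2' := hα.2
  have hμ1 : 1 ≤ μ := by
    rw [hμ]
    have := integral_mono_ae (integrable_const (1:ℝ)) hint (ae_ge_one ν hsupp)
    simpa using this
  have hμ0 : 0 < μ := by linarith
  obtain ⟨m2, hm2, hmu⟩ := mInt_upper α hα ν hsupp htail μ hμ1 k hk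
  obtain ⟨m1, hm1, n1, hml⟩ := mInt_lower α ν htail μ hμ1 k
  obtain ⟨D, hD, htu⟩ := two_upper α hα ν hsupp htail μ hμ1 k hk
  obtain ⟨x0, hx0, htl⟩ := two_lower α ν hsupp htail μ hμ1 k hk
  set θ := 1 + (γ - 1) / (2 * (α - 1)) with hθ
  have hθe : (1 - θ) * (2 - 2 * α) = γ - 1 := by
    have : α - 1 ≠ 0 := by linarith
    rw [hθ]; field_simp; ring
  have hk3 : (3:ℝ) ≤ k := by exact_mod_cast hk
  have hθ1 : θ < 1 := by
    by_contra hcon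
    push Not at hcon
    nlinarith
  have hθ2 : 1 / 2 ≤ θ := by
    by_contra hcon
    push Not at hcon
    nlinarith
  have hs : 0 < 2 * α - 2 := by linarith
  -- the two constants
  set c0 := (m1 / D) ^ (1 / (2 * α - 2)) with hc0
  have hc0p : 0 < c0 := by positivity
  have hc0e : c0 ^ (2 * α - 2) = m1 / D := by
    rw [hc0, ← Real.rpow_mul (by positivity), one_div_mul_cancel hs.ne', Real.rpow_one]
  set B := max 1 ((16 * μ * m2 + 1) ^ (1 / (2 * α - 2))) with hB
  have hB1 : 1 ≤ B := le_max_left _ _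
  have hB0 : 0 < B := by linarith
  have hBe : 16 * μ * m2 < B ^ (2 * α - 2) := by
    have h1 : ((16 * μ * m2 + 1) ^ (1 / (2 * α - 2))) ^ (2 * α - 2) ≤ B ^ (2 * α - 2) :=
      Real.rpow_le_rpow (by positivity) (le_max_right _ _) hs.le
    rw [← Real.rpow_mul (by positivity), one_div_mul_cancel hs.ne', Real.rpow_one] at h1
    linarith
  set C1 := μ * B with hC1
  have hC1p : 0 < C1 := by positivity
  have htend : Tendsto (fun n : ℕ => (n:ℝ) ^ (1 - θ)) atTop atTop :=
    (tendsto_rpow_atTop (by linarith)).comp tendsto_natCast_atTop_atTop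
  obtain ⟨n2, hn2⟩ := eventually_atTop.1 (htend.eventually_ge_atTop (x0 * B))
  refine ⟨min c0 C1, C1, max (max n1 n2) 2, lt_min hc0p hC1p, min_le_right _ _, fun n hn => ?_⟩
  have hnn1 : n1 ≤ n := ((le_max_left _ _).trans (le_max_left _ _)).trans hn
  have hnn2 : n2 ≤ n := ((le_max_right _ _).trans (le_max_left _ _)).trans hn
  have hn2' : 2 ≤ n := (le_max_right _ _).trans hn
  have hN1 : (1:ℝ) ≤ n := by exact_mod_cast (by omega : 1 ≤ n)
  have hN : (0:ℝ) < n := by linarith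
  have hNθ : 0 < (n:ℝ) ^ θ := Real.rpow_pos_of_pos hN _
  have hNγ : 0 < (n:ℝ) ^ γ := Real.rpow_pos_of_pos hN _
  have ha : 0 < (n : ℝ) ^ (γ - (k : ℝ) * (2 - α) / 2) := Real.rpow_pos_of_pos hN _
  have haγ : (n : ℝ) ^ (γ - (k : ℝ) * (2 - α) / 2) * (n : ℝ) ^ ((k : ℝ) * (2 - α) / 2)
      = (n:ℝ) ^ γ := by
    rw [← Real.rpow_add hN]; congr 1; ring
  set a := (n : ℝ) ^ (γ - (k : ℝ) * (2 - α) / 2) with hadef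
  have hlo : m1 * (n:ℝ) ^ γ ≤ a * mExp ν μ k n := by
    rw [← haγ]
    calc _ = a * (m1 * (n : ℝ) ^ ((k : ℝ) * (2 - α) / 2)) := by ring
      _ ≤ _ := mul_le_mul_of_nonneg_left (hml n hnn1) ha.le
  have hup : a * mExp ν μ k n ≤ m2 * (n:ℝ) ^ γ := by
    rw [← haγ]
    calc _ ≤ a * (m2 * (n : ℝ) ^ ((k : ℝ) * (2 - α) / 2)) :=
          mul_le_mul_of_nonneg_left (hmu n (by omega)) ha.le
      _ = _ := by ring
  have hdiv : (n:ℝ) / (n:ℝ) ^ θ = (n:ℝ) ^ (1 - θ) := by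
    rw [Real.rpow_sub hN, Real.rpow_one]
  have hpow : ((n:ℝ) ^ (1 - θ)) ^ (2 - 2 * α) = (n:ℝ) ^ (γ - 1) := by
    rw [← Real.rpow_mul hN.le, hθe]
  have hnγ : (n:ℝ) * (n:ℝ) ^ (γ - 1) = (n:ℝ) ^ γ := by
    rw [Real.rpow_sub hN, Real.rpow_one]; field_simp
  have hneg : ∀ z : ℝ, 0 < z → (z⁻¹) ^ (2 - 2 * α) = z ^ (2 * α - 2) := fun z hz => by
    rw [Real.inv_rpow hz.le, ← Real.rpow_neg hz.le]; congr 1; ring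
  have hmem : C1 * (n:ℝ) ^ θ ∈
      {c : ℝ | 0 < c ∧ a * mExp ν μ k n < (n.choose 2 : ℝ) * twoInt ν μ k n c} := by
    refine ⟨by positivity, ?_⟩
    have e : μ * n / (C1 * (n:ℝ) ^ θ) = B⁻¹ * (n:ℝ) ^ (1 - θ) := by
      rw [← hdiv, hC1]; field_simp
    have h1 := htl n hn2' (C1 * (n:ℝ) ^ θ) ?_ ?_ (by positivity)
    · refine hup.trans_lt (lt_of_lt_of_le ?_ h1)
      rw [e, Real.mul_rpow (by positivity) (by positivity), hneg B hB0, hpow]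
      calc m2 * (n:ℝ) ^ γ < (B ^ (2 * α - 2) / (16 * μ)) * (n:ℝ) ^ γ := by
            refine mul_lt_mul_of_pos_right ?_ hNγ
            rw [lt_div_iff₀ (by positivity)]; linarith
        _ = _ := by rw [← hnγ]; ring
    · rw [e, inv_mul_eq_div, le_div_iff₀ hB0]
      exact hn2 n hnn2
    · have h2 : (n:ℝ) ≤ ((n:ℝ) ^ θ) ^ 2 := by
        rw [← Real.rpow_natCast, ← Real.rpow_mul hN.le]
        calc (n:ℝ) = (n:ℝ) ^ (1:ℝ) := (Real.rpow_one _).symm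
          _ ≤ _ := Real.rpow_le_rpow_of_exponent_le hN1 (by push_cast; linarith)
      have h3 : μ ≤ C1 ^ 2 := by
        have : μ ≤ C1 := by rw [hC1]; nlinarith
        nlinarith
      rw [mul_pow]
      exact mul_le_mul h3 h2 hN.le (by positivity)
  constructor
  · refine le_csInf ⟨_, hmem⟩ fun c hc => ?_
    obtain ⟨hc0', hc2⟩ := hc
    refine (mul_le_mul_of_nonneg_right (min_le_left _ _) hNθ.le).trans ?_
    by_contra hlt
    push Not at hlt
    have h1 := htu n (by omega) c hc0'
    have h2 : ((n:ℝ) / c) ^ (2 - 2 * α) ≤ (c0⁻¹ * (n:ℝ) ^ (1 - θ)) ^ (2 - 2 * α) := by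
      refine Real.rpow_le_rpow_of_nonpos (by positivity) ?_ (by linarith)
      rw [← hdiv, inv_mul_eq_div, div_div, mul_comm _ c0]
      exact div_le_div_of_nonneg_left hN.le hc0' hlt.le
    rw [Real.mul_rpow (by positivity) (by positivity), hneg c0 hc0p, hpow, hc0e] at h2
    have h3 : D * n * ((n:ℝ) / c) ^ (2 - 2 * α) ≤ m1 * (n:ℝ) ^ γ := by
      calc _ ≤ D * n * (m1 / D * (n:ℝ) ^ (γ - 1)) := by gcongr
        _ = _ := by rw [← hnγ]; field_simp
    linarith
  · exact csInf_le ⟨0, fun c hc => hc.1.le⟩ hmem
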